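/- Let K be a henselian valued field of equicharacteristic zero. Consider a polynomial f(A,Y) = Σ_{i=0}^m A_i Y^i and elements a_0,…,a_m ∈ K, b ∈ K^×, such that (i) min{v(a_i b^i) : i = 0,…,m} = v(a_{i₀} b^{i₀}) < v(f(a,b)) for some i₀ ≥ 1, and (ii) v(∂f/∂Y(a,b)) = v(a_{i₀} b^{i₀−1}). Then there exists a unique β ∈ K with rv(β) = rv(b) and f(a,β) = 0. -/

import Mathlib

open Polynomial IsLocalRing in
/-- In a henselian local ring, an approximate simple root at `0` of a polynomial that need not be
monic lifts to a root. The root is `c₀ / z`, where `z` is a root near `-c₁` of the monic polynomial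
obtained by substituting `c₀ / Z` and clearing denominators. -/
theorem HenselianLocalRing.exists_root_mem_maximalIdeal {R : Type*} [CommRing R]
    [HenselianLocalRing R] (c₀ c₁ : R) (h : R[X]) (h₀ : c₀ ∈ maximalIdeal R) (h₁ : IsUnit c₁) :
    ∃ x ∈ maximalIdeal R, c₀ + c₁ * x + h.eval x * x ^ 2 = 0 := by
  set d := h.natDegree with hd
  set Q : R[X] := ∑ j ∈ Finset.range (d + 1), C (h.coeff j * c₀ ^ j) * X ^ (d - j) with hQ
  have hQdeg : Q.degree ≤ (d + 1 : ℕ) := by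
    refine (degree_sum_le _ _).trans (Finset.sup_le fun j _ => ?_)
    refine (degree_C_mul_X_pow_le _ _).trans ?_
    exact_mod_cast (by omega : d - j ≤ d + 1)
  set P : R[X] := X ^ (d + 2) + (C c₁ * X ^ (d + 1) + C c₀ * Q) with hP
  have hmonic : P.Monic := by
    refine monic_X_pow_add (lt_of_le_of_lt (b := ((d + 1 : ℕ) : WithBot ℕ)) ?_ ?_)
    · refine (degree_add_le _ _).trans (max_le (degree_C_mul_X_pow_le _ _) ?_)
      rw [C_mul']
      exact (degree_smul_le _ _).trans hQdeg
    · exact_mod_cast (by omega : d + 1 < d + 2)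
  have hval : P.eval (-c₁) ∈ maximalIdeal R := by
    have : P.eval (-c₁) = Q.eval (-c₁) * c₀ := by
      simp only [hP, eval_add, eval_mul, eval_pow, eval_X, eval_C]
      ring
    rw [this]
    exact Ideal.mul_mem_left _ _ h₀
  have hder : IsUnit (P.derivative.eval (-c₁)) := by
    have : P.derivative.eval (-c₁) = (-c₁) ^ (d + 1) + Q.derivative.eval (-c₁) * c₀ := by
      simp only [hP, derivative_add, derivative_mul, derivative_C, derivative_X_pow, eval_add,
        eval_mul, eval_pow, eval_X, eval_C, eval_zero, Nat.add_sub_cancel,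
        show d + 2 - 1 = d + 1 by omega]
      push_cast
      ring
    rw [this, ← notMem_maximalIdeal]
    intro hmem
    have := (Ideal.add_mem_iff_left _ (Ideal.mul_mem_left _ (Q.derivative.eval (-c₁)) h₀)).1 hmem
    exact notMem_maximalIdeal.2 (h₁.neg.pow _) this
  obtain ⟨z, hz, hzmem⟩ := HenselianLocalRing.is_henselian P hmonic (-c₁) hval hder
  have hzu : IsUnit z := by
    rw [← notMem_maximalIdeal]
    intro hmem
    have := Ideal.sub_mem _ hmem hzmem
    rw [sub_sub_cancel] at this
    exact notMem_maximalIdeal.2 h₁.neg this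
  obtain ⟨u, hu⟩ := hzu.exists_right_inv
  have hQz : z ^ d * h.eval (c₀ * u) = Q.eval z := by
    rw [eval_eq_sum_range, hQ, eval_finsetSum, Finset.mul_sum]
    refine Finset.sum_congr rfl fun j hj => ?_
    have hj' : j ≤ d := Nat.lt_succ_iff.1 (Finset.mem_range.1 hj)
    simp only [eval_mul, eval_pow, eval_X, eval_C]
    have hzd : z ^ d = z ^ (d - j) * z ^ j := by rw [← pow_add, Nat.sub_add_cancel hj']
    have huj : z ^ j * u ^ j = 1 := by rw [← mul_pow, hu, one_pow]
    rw [hzd, mul_pow]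
    linear_combination (z ^ (d - j) * h.coeff j * c₀ ^ j) * huj
  refine ⟨c₀ * u, Ideal.mul_mem_right _ _ h₀, (hzu.pow (d + 2)).mul_left_cancel ?_⟩
  have hz' : z ^ (d + 2) + (c₁ * z ^ (d + 1) + c₀ * Q.eval z) = 0 := by
    simpa [hP, IsRoot] using hz
  linear_combination c₀ * hz' + c₀ ^ 2 * z ^ 2 * u ^ 2 * hQz
    + (c₁ * c₀ * z ^ (d + 1) + c₀ ^ 2 * Q.eval z * (z * u + 1)) * hu

open Polynomial IsLocalRing in
/-- Hensel's lemma for polynomials that need not be monic, with uniqueness of the root. -/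
theorem HenselianLocalRing.existsUnique_isRoot {R : Type*} [CommRing R] [HenselianLocalRing R]
    (f : R[X]) (a : R) (hf : f.eval a ∈ maximalIdeal R) (hf' : IsUnit (f.derivative.eval a)) :
    ∃! x, x - a ∈ maximalIdeal R ∧ f.eval x = 0 := by
  rw [← taylor_coeff_zero] at hf
  have hu := hf'
  rw [← taylor_coeff_one] at hf'
  obtain ⟨x, hx, hroot⟩ := exists_root_mem_maximalIdeal _ _ (taylor a f).divX.divX hf hf'
  have hx0 : f.eval (x + a) = 0 := by
    have h₀ := congrArg (eval x) (divX_mul_X_add (taylor a f))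
    have h₁ := congrArg (eval x) (divX_mul_X_add (taylor a f).divX)
    simp only [eval_add, eval_mul, eval_X, eval_C, taylor_eval, coeff_divX, zero_add] at h₀ h₁
    linear_combination hroot - h₀ - x * h₁
  refine ⟨x + a, ⟨by simpa using hx, hx0⟩, fun y ⟨hy, hy0⟩ => ?_⟩
  refine (eq_of_eval_eq_zero_of_not_isUnit_sub hx0 hy0 ?_ ?_).symm
  · rw [← mem_nonunits_iff, ← mem_maximalIdeal]
    have := Ideal.sub_mem _ hx hy
    rwa [show x - (y - a) = x + a - y by ring] at this
  · obtain ⟨k, hk⟩ := evalSubFactor f.derivative (x + a) a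
    rw [add_sub_cancel_right] at hk
    rw [← notMem_maximalIdeal, ← sub_add_cancel (f.derivative.eval (x + a)), hk]
    intro hmem
    have := (Ideal.add_mem_iff_right _ (Ideal.mul_mem_left _ k hx)).1 hmem
    exact notMem_maximalIdeal.2 hu this

/-- The Cohen–Denef–Pas lemma.  Let `K` be a henselian valued field of
equicharacteristic zero, `f(a,Y) = ∑ aᵢ Yⁱ` and `b ≠ 0` such that (in
multiplicative notation, where additive `v(x) < v(y)` becomes `v y < v x`):
`v (a_{i₀} b^{i₀})` is the maximum of the `v (aᵢ bⁱ)` for some `i₀ ≥ 1`,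
`v (f(a,b)) < v (a_{i₀} b^{i₀})`, and
`v (∂f/∂Y (a,b)) = v (a_{i₀} b^{i₀-1})`.
Then there is a unique `β` with `rv β = rv b` (i.e. `v (β - b) < v b`) and
`f(a,β) = 0`. -/
theorem cohen_denef_pas {K : Type*} [Field K] [CharZero K] {Γ₀ : Type*}
    [LinearOrderedCommGroupWithZero Γ₀] (v : Valuation K Γ₀)
    [HenselianLocalRing v.valuationSubring]
    (hres : ∀ n : ℕ, n ≠ 0 → v (n : K) = 1)
    (m : ℕ) (a : Fin (m + 1) → K) (b : K) (hb : b ≠ 0)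
    (i₀ : Fin (m + 1)) (hi₀ : 1 ≤ (i₀ : ℕ))
    (hmax : ∀ i : Fin (m + 1), v (a i * b ^ (i : ℕ)) ≤ v (a i₀ * b ^ (i₀ : ℕ)))
    (hval : v (∑ i : Fin (m + 1), a i * b ^ (i : ℕ)) < v (a i₀ * b ^ (i₀ : ℕ)))
    (hder : v (∑ i : Fin (m + 1), (i : ℕ) * a i * b ^ ((i : ℕ) - 1))
      = v (a i₀ * b ^ ((i₀ : ℕ) - 1))) :
    ∃! β : K, v (β - b) < v b ∧ ∑ i : Fin (m + 1), a i * β ^ (i : ℕ) = 0 := by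
  have hc : a i₀ * b ^ (i₀ : ℕ) ≠ 0 := v.ne_zero_iff.1 (ne_zero_of_lt hval)
  set c := a i₀ * b ^ (i₀ : ℕ) with hcdef
  have hvc : 0 < v c := zero_lt_iff.2 (v.ne_zero_iff.2 hc)
  let r : Fin (m + 1) → v.valuationSubring := fun i =>
    ⟨a i * b ^ (i : ℕ) / c, by
      rw [Valuation.mem_valuationSubring_iff, map_div₀]
      exact div_le_one_of_le₀ (hmax i) zero_le⟩
  have hr : ∀ i, (r i : K) = a i * b ^ (i : ℕ) / c := fun _ => rfl
  let g : Polynomial v.valuationSubring :=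
    ∑ i : Fin (m + 1), Polynomial.C (r i) * Polynomial.X ^ (i : ℕ)
  have hg : ∀ y : v.valuationSubring,
      ((g.eval y : v.valuationSubring) : K) = (∑ i, a i * (b * y) ^ (i : ℕ)) / c := by
    intro y
    simp only [g, Polynomial.eval_finsetSum, Polynomial.eval_mul, Polynomial.eval_pow,
      Polynomial.eval_X, Polynomial.eval_C, Finset.sum_div]
    push_cast
    refine Finset.sum_congr rfl fun i _ => ?_
    rw [hr, mul_pow]
    ring
  have hg' : ((g.derivative.eval 1 : v.valuationSubring) : K)
      = b * (∑ i : Fin (m + 1), (i : ℕ) * a i * b ^ ((i : ℕ) - 1)) / c := by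
    simp only [g, Polynomial.derivative_sum, Polynomial.derivative_C_mul_X_pow,
      Polynomial.eval_finsetSum, Polynomial.eval_mul, Polynomial.eval_pow,
      Polynomial.eval_X, Polynomial.eval_C, Finset.mul_sum, Finset.sum_div]
    push_cast
    refine Finset.sum_congr rfl fun i _ => ?_
    rw [hr]
    rcases Nat.eq_zero_or_pos (i : ℕ) with h0 | hpos
    · simp [h0]
    · rw [← mul_pow_sub_one hpos.ne' b, one_pow]
      ring
  have hmem : ∀ y : v.valuationSubring,
      y - 1 ∈ IsLocalRing.maximalIdeal v.valuationSubring ↔ v (b * y - b) < v b := by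
    intro y
    rw [Valuation.mem_maximalIdeal_iff, show b * (y : K) - b = b * (y - 1) by ring, map_mul,
      mul_lt_iff_lt_one_right (zero_lt_iff.2 (v.ne_zero_iff.2 hb))]
    rfl
  have hzero : ∀ y : v.valuationSubring,
      g.eval y = 0 ↔ ∑ i, a i * (b * y) ^ (i : ℕ) = 0 := by
    intro y
    rw [← ZeroMemClass.coe_eq_zero, hg, div_eq_zero_iff, or_iff_left hc]
  obtain ⟨y, ⟨hy, hy0⟩, huniq⟩ := HenselianLocalRing.existsUnique_isRoot g 1
    (by
      rw [Valuation.mem_maximalIdeal_iff, hg, map_div₀, div_lt_one₀ hvc]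
      simpa using hval)
    (by
      refine (Valuation.integer.integers v).isUnit_of_one' ?_
      change v ((g.derivative.eval 1 : v.valuationSubring) : K) = 1
      rw [hg', map_div₀, map_mul, hder, ← map_mul, div_eq_one_iff_eq hvc.ne', hcdef,
        ← mul_pow_sub_one (by omega : (i₀ : ℕ) ≠ 0) b]
      congr 1
      ring)
  refine ⟨b * y, ⟨(hmem y).1 hy, (hzero y).1 hy0⟩, fun β ⟨hβ, hβ0⟩ => ?_⟩
  have hvβ : v β = v b := v.map_eq_of_sub_lt hβ
  let w : v.valuationSubring := ⟨β / b, by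
    rw [Valuation.mem_valuationSubring_iff, map_div₀, hvβ]
    exact div_self_le_one _⟩
  have hw : b * (w : K) = β := mul_div_cancel₀ β hb
  rw [← hw, huniq w ⟨(hmem w).2 (by rwa [hw]), (hzero w).2 (by rwa [hw])⟩]
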